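/- arXiv:1608.06465 — 7 statements merged into one kernel-verified Lean document; each statement's English description precedes it below -/
import Mathlib

section
/- If c and c' are integers with c ≡ c' (mod t), then 2t₁ divides g₁(d₁ + c²n₁) if and only if 2t₁ divides g₁(d₁ + c'²n₁). In other words, the condition '2t₁ divides g₁(d₁ + c²n₁)' depends only on the residue class of c modulo t. -/
/-- With the usual context (`n ≥ 2`, `d ≥ 1`, `t ≥ 1`, `t ∣ gcd(2d, 2n+2)`,
`g₀ = gcd(2d, 2n+2)`, `d₁ = 2d/g₀`, `n₁ = (2n+2)/g₀`, `g = g₀/t`, `w = gcd(g,t)`,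
`g₁ = g/w`, `t₁ = t/w`):
if `c ≡ c' (mod t)`, then `2t₁ ∣ g₁(d₁ + c²n₁)` iff `2t₁ ∣ g₁(d₁ + c'²n₁)`;
i.e. the condition depends only on the residue class of `c` modulo `t`. -/
theorem solution_condition_depends_only_on_residue
    (n d t g₀ d₁ n₁ g w g₁ t₁ : ℕ)
    (hn : 2 ≤ n) (hd : 1 ≤ d) (ht : 1 ≤ t)
    (hg₀ : g₀ = Nat.gcd (2 * d) (2 * n + 2))
    (htdvd : t ∣ g₀)
    (hd₁ : d₁ = 2 * d / g₀) (hn₁ : n₁ = (2 * n + 2) / g₀)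
    (hg : g = g₀ / t) (hw : w = Nat.gcd g t)
    (hg₁ : g₁ = g / w) (ht₁ : t₁ = t / w) :
    ∀ c c' : ℤ, c ≡ c' [ZMOD (t : ℤ)] →
      ((2 * (t₁ : ℤ)) ∣ ((g₁ : ℤ) * ((d₁ : ℤ) + c ^ 2 * (n₁ : ℤ))) ↔
       (2 * (t₁ : ℤ)) ∣ ((g₁ : ℤ) * ((d₁ : ℤ) + c' ^ 2 * (n₁ : ℤ)))) := by
  intro c c' hcc
  have hwg : g = g₁ * w := by
    rw [hg₁, Nat.div_mul_cancel (hw ▸ Nat.gcd_dvd_left g t)]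
  have hwt : t = t₁ * w := by
    rw [ht₁, Nat.div_mul_cancel (hw ▸ Nat.gcd_dvd_right g t)]
  have hgt : g₀ = g * t := by rw [hg, Nat.div_mul_cancel htdvd]
  obtain ⟨m, hm⟩ : 2 ∣ g₀ := hg₀ ▸ Nat.dvd_gcd ⟨d, rfl⟩ ⟨n + 1, by ring⟩
  obtain ⟨k, hk⟩ := hcc.dvd
  have hk' : c' = c + t * k := by linarith
  have hsq : (g₁ : ℤ) * t * t = 2 * t₁ * m := by
    have h : g₁ * t * t = 2 * t₁ * m := by
      calc g₁ * t * t = t₁ * ((g₁ * w) * t) := by nth_rw 1 [hwt]; ring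
        _ = 2 * t₁ * m := by rw [← hwg, ← hgt, hm]; ring
    exact_mod_cast h
  have htz : (t : ℤ) = t₁ * w := by exact_mod_cast hwt
  have hdiff : (g₁ : ℤ) * (d₁ + c' ^ 2 * n₁) =
      g₁ * (d₁ + c ^ 2 * n₁) + 2 * t₁ * (g₁ * w * k * c * n₁ + m * k ^ 2 * n₁) := by
    rw [hk']
    linear_combination (k ^ 2 * n₁ : ℤ) * hsq + (2 * g₁ * k * c * n₁ : ℤ) * htz
  rw [hdiff]
  exact (dvd_add_left (dvd_mul_right _ _)).symm
end

section
/- Assume t > 2. Then the map c ↦ −c is a well-defined fixed-point-free involution on the set of residue classes c modulo t with gcd(c, t) = 1 satisfying 2t₁ ∣ g₁(d₁ + c²n₁); consequently the number N(n,d,t) of such residue classes is even. -/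
/-- A type carrying a fixed-point-free involution has even cardinality. -/
theorem even_natCard_of_involutive {α : Type*} {f : α → α} (hf : Function.Involutive f)
    (hne : ∀ a, f a ≠ a) : Even (Nat.card α) := by
  classical
  cases finite_or_infinite α with
  | inr h => simp
  | inl h =>
    have := Fintype.ofFinite α
    rw [Nat.card_eq_fintype_card, even_iff_two_dvd, ← ZMod.natCast_eq_zero_iff]
    have hsum : ∑ _a : α, (1 : ZMod 2) = 0 :=
      Finset.sum_involution (fun a _ => f a) (fun _ _ => by decide) (fun a _ _ => hne a)
        (fun _ _ => Finset.mem_univ _) (fun a _ => hf a)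
    simpa using hsum

/-- If `t` or `g` is even, then `2 (t / w)` divides `(g / w) t²`, where `w = gcd(g, t)`. -/
theorem two_mul_div_gcd_dvd {g t : ℕ} (ht : 0 < t) (heven : 2 ∣ g * t) :
    2 * (t / g.gcd t) ∣ g / g.gcd t * t ^ 2 := by
  obtain ⟨g₁, hg₁⟩ := Nat.gcd_dvd_left g t
  obtain ⟨t₁, ht₁⟩ := Nat.gcd_dvd_right g t
  have hw : 0 < g.gcd t := Nat.gcd_pos_of_pos_right g ht
  set w := g.gcd t
  have hmul : 2 ∣ g₁ * w * t := by
    rwa [mul_comm g₁ w, ← hg₁]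
  have hg : g / w = g₁ := by rw [hg₁, Nat.mul_div_cancel_left _ hw]
  have ht' : t / w = t₁ := by
    conv_lhs => rw [ht₁]
    exact Nat.mul_div_cancel_left _ hw
  rw [hg, ht']
  have hsq : g₁ * t ^ 2 = g₁ * w * t * t₁ := by
    calc g₁ * t ^ 2 = g₁ * t * t := by ring
      _ = g₁ * t * (w * t₁) := by rw [← ht₁]
      _ = g₁ * w * t * t₁ := by ring
  rw [hsq]
  exact mul_dvd_mul_right hmul t₁

/-- Replacing `c` by `t - c` preserves divisibility of `a (b + c² e)` by `2m`. -/
theorem two_mul_dvd_of_reflect {m t a b c e : ℤ} (hm : m ∣ t) (hsq : 2 * m ∣ a * t ^ 2)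
    (h : 2 * m ∣ a * (b + c ^ 2 * e)) : 2 * m ∣ a * (b + (t - c) ^ 2 * e) := by
  have hlin : 2 * m ∣ 2 * t := mul_dvd_mul_left 2 hm
  have heq : a * (b + (t - c) ^ 2 * e)
      = a * (b + c ^ 2 * e) + a * t ^ 2 * e - 2 * t * (a * c * e) := by ring
  rw [heq]
  exact ((h.add (hsq.mul_right e)).sub (hlin.mul_right _))

/-- A unit residue modulo `t > 2` is not its own negative. -/
theorem ZMod.neg_ne_self_of_gcd_val_eq_one {t : ℕ} (ht : 2 < t) {c : ZMod t}
    (hc : c.val.gcd t = 1) : -c ≠ c := by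
  intro h
  rcases (ZMod.neg_eq_self_iff c).1 h with rfl | h
  · simp at hc
    omega
  · rw [Nat.gcd_eq_left (Dvd.intro_left 2 h)] at hc
    omega

/-- With the usual context and `t > 2`: the map `c ↦ -c` is a well-defined
fixed-point-free involution on the set of residue classes `c` modulo `t` with
`gcd(c, t) = 1` satisfying `2t₁ ∣ g₁(d₁ + c²n₁)`; consequently the number
`N(n,d,t)` of such residue classes is even. -/
theorem neg_involution_and_card_even
    (n d t g₀ d₁ n₁ g w g₁ t₁ : ℕ)
    (hn : 2 ≤ n) (hd : 1 ≤ d) (ht : 2 < t)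
    (hg₀ : g₀ = Nat.gcd (2 * d) (2 * n + 2))
    (htdvd : t ∣ g₀)
    (hd₁ : d₁ = 2 * d / g₀) (hn₁ : n₁ = (2 * n + 2) / g₀)
    (hg : g = g₀ / t) (hw : w = Nat.gcd g t)
    (hg₁ : g₁ = g / w) (ht₁ : t₁ = t / w) :
    (∀ c : ZMod t,
        (Nat.gcd c.val t = 1 ∧
          (2 * (t₁ : ℤ)) ∣ ((g₁ : ℤ) * ((d₁ : ℤ) + (c.val : ℤ) ^ 2 * (n₁ : ℤ)))) →
        (Nat.gcd (-c).val t = 1 ∧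
          (2 * (t₁ : ℤ)) ∣ ((g₁ : ℤ) * ((d₁ : ℤ) + ((-c).val : ℤ) ^ 2 * (n₁ : ℤ))))) ∧
    (∀ c : ZMod t,
        (Nat.gcd c.val t = 1 ∧
          (2 * (t₁ : ℤ)) ∣ ((g₁ : ℤ) * ((d₁ : ℤ) + (c.val : ℤ) ^ 2 * (n₁ : ℤ)))) →
        -c ≠ c) ∧
    Even (Nat.card
      {c : ZMod t //
        Nat.gcd c.val t = 1 ∧
          (2 * (t₁ : ℤ)) ∣ ((g₁ : ℤ) * ((d₁ : ℤ) + (c.val : ℤ) ^ 2 * (n₁ : ℤ)))}) := by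
  have hfix : ∀ c : ZMod t, Nat.gcd c.val t = 1 → -c ≠ c :=
    fun c => ZMod.neg_ne_self_of_gcd_val_eq_one ht
  have hgt : 2 ∣ g * t := by
    rw [hg, Nat.div_mul_cancel htdvd, hg₀]
    exact Nat.dvd_gcd (by omega) (by omega)
  have hsq : 2 * (t₁ : ℤ) ∣ (g₁ : ℤ) * (t : ℤ) ^ 2 := by
    subst hg₁ ht₁ hw
    exact_mod_cast two_mul_div_gcd_dvd (by omega) hgt
  have ht₁t : (t₁ : ℤ) ∣ t := by
    subst ht₁ hw
    exact_mod_cast Nat.div_dvd_of_dvd (Nat.gcd_dvd_right g t)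
  have hneg : ∀ c : ZMod t,
      (Nat.gcd c.val t = 1 ∧
        (2 * (t₁ : ℤ)) ∣ ((g₁ : ℤ) * ((d₁ : ℤ) + (c.val : ℤ) ^ 2 * (n₁ : ℤ)))) →
      (Nat.gcd (-c).val t = 1 ∧
        (2 * (t₁ : ℤ)) ∣ ((g₁ : ℤ) * ((d₁ : ℤ) + ((-c).val : ℤ) ^ 2 * (n₁ : ℤ)))) := by
    rintro c ⟨hc, hdvd⟩
    have : NeZero t := ⟨by omega⟩
    have hc₀ : c ≠ 0 := by
      rintro rfl
      exact hfix 0 hc neg_zero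
    have : NeZero c := ⟨hc₀⟩
    have hle : c.val ≤ t := (ZMod.val_lt c).le
    rw [ZMod.val_neg_of_ne_zero]
    refine ⟨by rwa [Nat.gcd_self_sub_left hle], ?_⟩
    rw [Nat.cast_sub hle]
    exact two_mul_dvd_of_reflect ht₁t hsq hdvd
  refine ⟨hneg, fun c hc => hfix c hc.1, ?_⟩
  exact even_natCard_of_involutive (f := fun c => ⟨-c.1, hneg c.1 c.2⟩)
    (fun c => Subtype.ext (neg_neg c.1))
    (fun c h => hfix c.1 c.2.1 (congrArg Subtype.val h))
end

section
/- Assume t > 2, g₁ is even, gcd(d₁, t₁) = 1, gcd(n₁, t₁) = 1, and there exists an integer x with n₁x² + d₁ ≡ 0 (mod t₁). Then N(n,d,t) = w₊(t₁)·φ(w₋(t₁))·2^{ρ(t₁)}. -/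
/-- `wplus w t₁` is the largest divisor of `w` all of whose prime factors divide `t₁`:
the product of the prime powers `p ^ (v_p w)` over primes `p` dividing `gcd(w, t₁)`. -/
def wplus (w t₁ : ℕ) : ℕ :=
  ∏ p ∈ w.primeFactors ∩ t₁.primeFactors, p ^ (w.factorization p)

/-- `wminus w t₁ = w / wplus w t₁`. -/
def wminus (w t₁ : ℕ) : ℕ := w / wplus w t₁

/-- The preimage of a finset under a surjective homomorphism of finite groups has the expected
density. -/
lemma MonoidHom.card_preimage_mul_card {G H : Type*} [Group G] [Group H] [Fintype G] [Fintype H]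
    [DecidableEq H] (f : G →* H) (hf : Function.Surjective f) (S : Finset H) :
    (Finset.univ.filter (fun u => f u ∈ S)).card * Fintype.card H = S.card * Fintype.card G := by
  have fiber (h : H) : (Finset.univ.filter (fun u => f u = h)).card =
      (Finset.univ.filter (fun u => f u = 1)).card :=
    MonoidHom.card_fiber_eq_of_mem_range f (hf h) (hf 1)
  have count (T : Finset H) : (Finset.univ.filter (fun u => f u ∈ T)).card =
      T.card * (Finset.univ.filter (fun u => f u = 1)).card := by
    rw [Finset.card_eq_sum_card_fiberwise (f := f) (t := T) (fun u hu => by simpa using hu),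
      ← smul_eq_mul, ← Finset.sum_const]
    refine Finset.sum_congr rfl fun h hh => ?_
    rw [← fiber h, Finset.filter_filter]
    congr 1
    ext u
    simp only [Finset.mem_filter, Finset.mem_univ, true_and]
    exact ⟨fun hu => hu.2, fun hu => ⟨hu ▸ hh, hu⟩⟩
  have total := count Finset.univ
  simp only [Finset.mem_univ, Finset.filter_true, Finset.card_univ] at total
  rw [count, total]
  ring

/-- In `ℤ / p ^ k` with `p` an odd prime, the only square roots of `1` are `1` and `-1`. -/
lemma ZMod.sq_eq_one_iff_of_odd_prime_pow {p k : ℕ} (hp : p.Prime) (hodd : Odd p)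
    (x : ZMod (p ^ k)) : x ^ 2 = 1 ↔ x = 1 ∨ x = -1 := by
  refine ⟨fun h => ?_, by rintro (rfl | rfl) <;> ring⟩
  obtain ⟨y, rfl⟩ := ZMod.intCast_surjective x
  have hdvd : ((p ^ k : ℕ) : ℤ) ∣ (y - 1) * (y + 1) := by
    rw [← ZMod.intCast_zmod_eq_zero_iff_dvd]
    push_cast
    linear_combination h
  have hp' : Prime (p : ℤ) := Nat.prime_iff_prime_int.mp hp
  have htwo : ¬ (p : ℤ) ∣ 2 := fun h2 => by
    have h2' : p ∣ 2 := by exact_mod_cast h2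
    rw [Nat.prime_dvd_prime_iff_eq hp Nat.prime_two] at h2'
    subst h2'
    exact absurd hodd (by decide)
  push_cast at hdvd
  by_cases h1 : (p : ℤ) ∣ y - 1
  · have h3 : ¬ (p : ℤ) ∣ y + 1 := fun h3 => htwo (by
      have := dvd_sub h3 h1
      ring_nf at this
      exact this)
    have h4 : ((p ^ k : ℕ) : ℤ) ∣ y - 1 := by
      push_cast
      exact (IsCoprime.pow_left ((hp'.coprime_iff_not_dvd).mpr h3)).dvd_of_dvd_mul_right hdvd
    left
    rw [← ZMod.intCast_zmod_eq_zero_iff_dvd] at h4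
    push_cast at h4
    linear_combination h4
  · have h4 : ((p ^ k : ℕ) : ℤ) ∣ y + 1 := by
      push_cast
      exact (IsCoprime.pow_left ((hp'.coprime_iff_not_dvd).mpr h1)).dvd_of_dvd_mul_left hdvd
    right
    rw [← ZMod.intCast_zmod_eq_zero_iff_dvd] at h4
    push_cast at h4
    linear_combination h4

/-- An odd modulus `m` has `2 ^ ρ(m)` square roots of unity. -/
lemma ZMod.card_sq_eq_one_of_odd (m : ℕ) (hm : Odd m) :
    Nat.card {x : ZMod m // x ^ 2 = 1} = 2 ^ m.primeFactors.card := by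
  induction m using Nat.recOnPosPrimePosCoprime with
  | zero => exact absurd hm (by decide)
  | one => simp [Nat.card_eq_fintype_card, Subsingleton.elim _ (1 : ZMod 1)]
  | prime_pow p k hp hk =>
    have hodd : Odd p := Nat.Odd.of_mul_left (n := p ^ (k - 1)) (by
      rwa [← pow_succ', Nat.sub_add_cancel hk])
    have hlt : 2 < p ^ k := by
      have h2 : 2 < p := lt_of_le_of_ne hp.two_le (by rintro rfl; exact absurd hodd (by decide))
      exact h2.trans_le (Nat.le_self_pow hk.ne' p)
    have : Fact (2 < p ^ k) := ⟨hlt⟩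
    have hset : {x : ZMod (p ^ k) | x ^ 2 = 1} = {1, -1} := by
      ext x
      simpa using ZMod.sq_eq_one_iff_of_odd_prime_pow hp hodd x
    rw [Nat.primeFactors_prime_pow hk.ne' hp, Finset.card_singleton, pow_one]
    change Nat.card ({x : ZMod (p ^ k) | x ^ 2 = 1} : Set _) = 2
    rw [hset, Nat.card_coe_set_eq, Set.ncard_pair ZMod.neg_one_ne_one.symm]
  | coprime a b ha hb hab iha ihb =>
    rw [Nat.odd_mul] at hm
    rw [hab.primeFactors_mul, Finset.card_union_of_disjoint hab.disjoint_primeFactors, pow_add,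
      ← iha hm.1, ← ihb hm.2, ← Nat.card_prod]
    let e := ZMod.chineseRemainder hab
    have he (x : ZMod (a * b)) : x ^ 2 = 1 ↔ (e x).1 ^ 2 = 1 ∧ (e x).2 ^ 2 = 1 := by
      rw [← e.injective.eq_iff, map_pow, map_one, Prod.ext_iff]
      rfl
    exact Nat.card_congr ((e.toEquiv.subtypeEquiv he).trans
      (Equiv.subtypeProdEquivProd (p := fun x : ZMod a => x ^ 2 = 1)
        (q := fun x : ZMod b => x ^ 2 = 1)))

lemma ZMod.card_units_sq_eq_sq_of_odd (m : ℕ) [NeZero m] (hm : Odd m) (a : (ZMod m)ˣ) :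
    (Finset.univ.filter (fun y : (ZMod m)ˣ => y ^ 2 = a ^ 2)).card = 2 ^ m.primeFactors.card := by
  have h := MonoidHom.card_fiber_eq_of_mem_range (powMonoidHom 2 : (ZMod m)ˣ →* (ZMod m)ˣ)
    (x := a ^ 2) (y := 1) ⟨a, rfl⟩ ⟨1, by simp⟩
  simp only [powMonoidHom_apply] at h
  rw [h, ← ZMod.card_sq_eq_one_of_odd m hm, Nat.card_eq_fintype_card, Fintype.card_subtype]
  refine Finset.card_bij (fun u _ => (u : ZMod m)) (fun u hu => ?_)
    (fun u _ v _ huv => Units.ext huv) (fun x hx => ?_)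
  · simp only [Finset.mem_filter, Finset.mem_univ, true_and] at hu ⊢
    rw [← Units.val_pow_eq_pow_val, hu, Units.val_one]
  · simp only [Finset.mem_filter, Finset.mem_univ, true_and] at hx
    exact ⟨Units.ofPowEqOne x 2 hx two_ne_zero, by simp [Units.ext_iff, hx], rfl⟩

lemma wplus_mul_prod_sdiff {w : ℕ} (hw : w ≠ 0) (m : ℕ) :
    wplus w m * ∏ p ∈ w.primeFactors \ m.primeFactors, p ^ w.factorization p = w := by
  rw [wplus, Finset.prod_inter_mul_prod_sdiff]
  exact Nat.prod_factorization_pow_eq_self hw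

lemma wplus_pos (w m : ℕ) : 0 < wplus w m :=
  Finset.prod_pos fun _ hp =>
    pow_pos (Nat.prime_of_mem_primeFactors (Finset.mem_inter.mp hp).1).pos _

lemma wminus_eq_prod {w : ℕ} (hw : w ≠ 0) (m : ℕ) :
    wminus w m = ∏ p ∈ w.primeFactors \ m.primeFactors, p ^ w.factorization p :=
  Nat.div_eq_of_eq_mul_right (wplus_pos w m) (wplus_mul_prod_sdiff hw m).symm

lemma wplus_mul_wminus {w : ℕ} (hw : w ≠ 0) (m : ℕ) : wplus w m * wminus w m = w := by
  rw [wminus_eq_prod hw, wplus_mul_prod_sdiff hw]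

lemma coprime_wminus {w m : ℕ} (hw : w ≠ 0) (hm : m ≠ 0) : Nat.Coprime (wminus w m) m := by
  rw [wminus_eq_prod hw]
  refine Nat.Coprime.prod_left fun p hp => Nat.Coprime.pow_left _ ?_
  rw [Finset.mem_sdiff] at hp
  have hpp := Nat.prime_of_mem_primeFactors hp.1
  exact (Nat.Prime.coprime_iff_not_dvd hpp).mpr fun h =>
    hp.2 (Nat.mem_primeFactors.mpr ⟨hpp, h, hm⟩)

lemma coprime_wminus_wplus {w m : ℕ} (hw : w ≠ 0) (hm : m ≠ 0) :
    Nat.Coprime (wminus w m) (wplus w m) :=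
  Nat.Coprime.prod_right fun _ hp => Nat.Coprime.pow_right _ <|
    (coprime_wminus hw hm).coprime_dvd_right
      (Nat.dvd_of_mem_primeFactors (Finset.mem_inter.mp hp).2)

lemma Nat.totient_prime_pow_mul_of_dvd {p m : ℕ} (hp : p.Prime) (h : p ∣ m) (k : ℕ) :
    Nat.totient (p ^ k * m) = p ^ k * Nat.totient m := by
  induction k with
  | zero => simp
  | succ k ih =>
    rw [pow_succ', mul_assoc, Nat.totient_mul_of_prime_of_dvd hp (h.mul_left _), ih, mul_assoc]

lemma totient_wplus_mul (w m : ℕ) : Nat.totient (wplus w m * m) = wplus w m * Nat.totient m := by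
  have key (s : Finset ℕ) (hs : s ⊆ m.primeFactors) :
      Nat.totient ((∏ p ∈ s, p ^ w.factorization p) * m) =
        (∏ p ∈ s, p ^ w.factorization p) * Nat.totient m := by
    induction s using Finset.induction_on with
    | empty => simp
    | insert p s hps ih =>
      have hp := hs (Finset.mem_insert_self p s)
      rw [Finset.prod_insert hps, mul_assoc,
        Nat.totient_prime_pow_mul_of_dvd (Nat.prime_of_mem_primeFactors hp)
          ((Nat.dvd_of_mem_primeFactors hp).mul_left _),
        ih ((Finset.subset_insert p s).trans hs), mul_assoc]
  exact key _ Finset.inter_subset_right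

lemma totient_mul_eq_wplus_mul {w m : ℕ} (hw : w ≠ 0) (hm : m ≠ 0) :
    Nat.totient (w * m) = wplus w m * Nat.totient (wminus w m) * Nat.totient m := by
  have h : w * m = wminus w m * (wplus w m * m) := by
    conv_lhs => rw [← wplus_mul_wminus hw m]
    ring
  rw [h, Nat.totient_mul ((coprime_wminus_wplus hw hm).mul_right (coprime_wminus hw hm)),
    totient_wplus_mul]
  ring

/-- The number of units of `ℤ / t` whose square reduces to a given unit square modulo an odd
divisor `m` of `t = w * m`. -/
lemma card_units_sq_eq_sq_mod {w m t : ℕ} [NeZero t] [NeZero m] (ht : t = w * m) (hmt : m ∣ t)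
    (hm : Odd m) (a : (ZMod m)ˣ) :
    (Finset.univ.filter (fun u : (ZMod t)ˣ => ZMod.unitsMap hmt u ^ 2 = a ^ 2)).card =
      wplus w m * Nat.totient (wminus w m) * 2 ^ m.primeFactors.card := by
  have hw : w ≠ 0 := by
    rintro rfl
    exact NeZero.ne t (by simpa using ht)
  have h := MonoidHom.card_preimage_mul_card (ZMod.unitsMap hmt) (ZMod.unitsMap_surjective hmt)
    (Finset.univ.filter (fun y : (ZMod m)ˣ => y ^ 2 = a ^ 2))
  simp only [Finset.mem_filter, Finset.mem_univ, true_and] at h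
  rw [ZMod.card_units_sq_eq_sq_of_odd m hm, ZMod.card_units_eq_totient,
    ZMod.card_units_eq_totient] at h
  have htot : Nat.totient t = wplus w m * Nat.totient (wminus w m) * Nat.totient m := by
    rw [ht, totient_mul_eq_wplus_mul hw (NeZero.ne m)]
  rw [htot] at h
  refine Nat.eq_of_mul_eq_mul_right (Nat.totient_pos.mpr (NeZero.pos m)) (h.trans ?_)
  ring

/-- Residues modulo `t` coprime to `t` correspond to units of `ℤ / t`. -/
lemma card_filter_range_coprime (t : ℕ) [NeZero t] (P : ℕ → Prop) [DecidablePred P] :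
    ((Finset.range t).filter (fun c => Nat.gcd c t = 1 ∧ P c)).card =
      (Finset.univ.filter (fun u : (ZMod t)ˣ => P (u : ZMod t).val)).card := by
  symm
  refine Finset.card_bij (fun u _ => (u : ZMod t).val) (fun u hu => ?_)
    (fun u _ v _ huv => Units.ext (ZMod.val_injective t huv)) (fun c hc => ?_)
  · simp only [Finset.mem_filter, Finset.mem_univ, true_and, Finset.mem_range] at hu ⊢
    exact ⟨ZMod.val_lt _, ZMod.val_coe_unit_coprime u, hu⟩
  · simp only [Finset.mem_filter, Finset.mem_range] at hc
    have hval : (ZMod.unitOfCoprime c hc.2.1 : ZMod t).val = c := by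
      rw [ZMod.coe_unitOfCoprime, ZMod.val_natCast_of_lt hc.1]
    refine ⟨ZMod.unitOfCoprime c hc.2.1, ?_, hval⟩
    rw [Finset.mem_filter, hval]
    exact ⟨Finset.mem_univ _, hc.2.2⟩

lemma two_mul_dvd_mul_iff {g m : ℕ} (hg : Even g) (hgm : Nat.Coprime g m) (z : ℤ) :
    2 * (m : ℤ) ∣ (g : ℤ) * z ↔ (m : ℤ) ∣ z := by
  constructor
  · intro h
    exact (Nat.isCoprime_iff_coprime.mpr hgm).symm.dvd_of_dvd_mul_left
      ((Dvd.intro_left 2 rfl).trans h)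
  · intro h
    exact mul_dvd_mul (by exact_mod_cast hg.two_dvd) h

/-- (see paper, Theorem on |Υ_n^{d,t}|)
`N(n,d,t)` is the number of residue classes `c` mod `t` with `gcd(c,t) = 1` and
`2t₁ ∣ g₁(d₁ + c²n₁)`. -/
theorem count_case_A_t_large
    (n d t g₀ d₁ n₁ g w g₁ t₁ : ℕ)
    (hn : 2 ≤ n) (hd : 1 ≤ d) (ht : 2 < t)
    (hg₀ : g₀ = Nat.gcd (2 * d) (2 * n + 2))
    (htdvd : t ∣ g₀)
    (hd₁ : d₁ = 2 * d / g₀) (hn₁ : n₁ = (2 * n + 2) / g₀)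
    (hg : g = g₀ / t) (hw : w = Nat.gcd g t)
    (hg₁ : g₁ = g / w) (ht₁ : t₁ = t / w)
    (hg₁even : Even g₁)
    (hd₁t₁ : Nat.gcd d₁ t₁ = 1) (hn₁t₁ : Nat.gcd n₁ t₁ = 1)
    (hQR : ∃ x : ℤ, (t₁ : ℤ) ∣ ((n₁ : ℤ) * x ^ 2 + (d₁ : ℤ))) :
    ((Finset.range t).filter
        (fun c : ℕ => Nat.gcd c t = 1 ∧
          (2 * (t₁ : ℤ)) ∣ ((g₁ : ℤ) * ((d₁ : ℤ) + (c : ℤ) ^ 2 * (n₁ : ℤ))))).card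
      = wplus w t₁ * Nat.totient (wminus w t₁) * 2 ^ t₁.primeFactors.card := by
  have ht0 : 0 < t := by omega
  have hw0 : 0 < w := hw ▸ Nat.gcd_pos_of_pos_right g ht0
  have hwt : w ∣ t := hw ▸ Nat.gcd_dvd_right g t
  have htw : t = w * t₁ := by rw [ht₁, Nat.mul_div_cancel' hwt]
  have hmt : t₁ ∣ t := Dvd.intro_left w htw.symm
  have ht₁0 : 0 < t₁ := Nat.pos_of_dvd_of_pos hmt ht0
  have : NeZero t := ⟨ht0.ne'⟩
  have : NeZero t₁ := ⟨ht₁0.ne'⟩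
  have hcop : Nat.Coprime g₁ t₁ := by
    rw [hg₁, ht₁, hw]
    exact Nat.coprime_div_gcd_div_gcd (hw ▸ hw0)
  have hodd : Odd t₁ := (hcop.coprime_dvd_left hg₁even.two_dvd).odd_of_left
  obtain ⟨x, hx⟩ := hQR
  have hx' : (n₁ : ZMod t₁) * (x : ZMod t₁) ^ 2 + d₁ = 0 := by
    rw [← ZMod.intCast_zmod_eq_zero_iff_dvd] at hx
    exact_mod_cast hx
  have hn₁unit : IsUnit (n₁ : ZMod t₁) := (ZMod.isUnit_iff_coprime _ _).mpr hn₁t₁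
  have hd₁unit : IsUnit (d₁ : ZMod t₁) := (ZMod.isUnit_iff_coprime _ _).mpr hd₁t₁
  have hxunit : IsUnit (x : ZMod t₁) := by
    have h : (d₁ : ZMod t₁) = x * (-(n₁ * x)) := by linear_combination hx'
    exact isUnit_of_mul_isUnit_left (h ▸ hd₁unit)
  obtain ⟨a, ha⟩ := hxunit
  rw [card_filter_range_coprime, ← card_units_sq_eq_sq_mod htw hmt hodd a]
  congr 1
  refine Finset.filter_congr fun u _ => ?_
  have hu : ((ZMod.unitsMap hmt u : (ZMod t₁)ˣ) : ZMod t₁) = ((u : ZMod t).val : ZMod t₁) := by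
    rw [ZMod.unitsMap_val, ZMod.cast_eq_val]
  rw [two_mul_dvd_mul_iff hg₁even hcop, ← ZMod.intCast_zmod_eq_zero_iff_dvd, Units.ext_iff,
    Units.val_pow_eq_pow_val, Units.val_pow_eq_pow_val, hu, ha]
  push_cast
  constructor
  · intro h
    exact hn₁unit.mul_left_cancel (by linear_combination h - hx')
  · intro h
    linear_combination n₁ * h + hx'
end

section
/- Assume t ≤ 2, the integers g₁, t₁ and d₁ are all odd, gcd(d₁, t₁) = 1, gcd(n₁, 2t₁) = 1, and there exists an integer x with n₁x² + d₁ ≡ 0 (mod 2t₁). Then N(n,d,t) = 1. -/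
/-- (see paper, Theorem on |Υ_n^{d,t}|)
`N(n,d,t)` is the number of residue classes `c` mod `t` with `gcd(c,t) = 1` and
`2t₁ ∣ g₁(d₁ + c²n₁)`. -/
theorem count_case_B_t_small
    (n d t g₀ d₁ n₁ g w g₁ t₁ : ℕ)
    (hn : 2 ≤ n) (hd : 1 ≤ d) (ht : 1 ≤ t) (ht2 : t ≤ 2)
    (hg₀ : g₀ = Nat.gcd (2 * d) (2 * n + 2))
    (htdvd : t ∣ g₀)
    (hd₁ : d₁ = 2 * d / g₀) (hn₁ : n₁ = (2 * n + 2) / g₀)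
    (hg : g = g₀ / t) (hw : w = Nat.gcd g t)
    (hg₁ : g₁ = g / w) (ht₁ : t₁ = t / w)
    (hg₁odd : Odd g₁) (ht₁odd : Odd t₁) (hd₁odd : Odd d₁)
    (hd₁t₁ : Nat.gcd d₁ t₁ = 1) (hn₁2t₁ : Nat.gcd n₁ (2 * t₁) = 1)
    (hQR : ∃ x : ℤ, (2 * (t₁ : ℤ)) ∣ ((n₁ : ℤ) * x ^ 2 + (d₁ : ℤ))) :
    ((Finset.range t).filter
        (fun c : ℕ => Nat.gcd c t = 1 ∧
          (2 * (t₁ : ℤ)) ∣ ((g₁ : ℤ) * ((d₁ : ℤ) + (c : ℤ) ^ 2 * (n₁ : ℤ))))).card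
      = 1 := by
  have hg₀even : 2 ∣ g₀ := hg₀ ▸ Nat.dvd_gcd ⟨d, rfl⟩ ⟨n + 1, by ring⟩
  have hn₁odd : Odd n₁ :=
    Nat.coprime_two_right.mp (Nat.Coprime.coprime_mul_right_right hn₁2t₁)
  obtain rfl | rfl : t = 1 ∨ t = 2 := by omega
  · -- For `t = 1` we get `g₁ = g₀`, which is even.
    have hg₁g₀ : g₁ = g₀ := by simp [hg₁, hw, hg]
    rw [hg₁g₀] at hg₁odd
    exact absurd hg₀even hg₁odd.not_two_dvd_nat
  · have hwdvd : w ∣ 2 := hw ▸ Nat.gcd_dvd_right g 2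
    have ht₁one : t₁ = 1 := by
      obtain h | h := (Nat.dvd_prime Nat.prime_two).mp hwdvd
      · rw [ht₁, h] at ht₁odd
        exact absurd ht₁odd (by decide)
      · rw [ht₁, h]
    have hdvd : (2 : ℤ) ∣ (g₁ : ℤ) * ((d₁ : ℤ) + (n₁ : ℤ)) :=
      Dvd.dvd.mul_left (by exact_mod_cast (hd₁odd.add_odd hn₁odd).two_dvd) _
    rw [Finset.card_eq_one]
    refine ⟨1, Finset.ext fun c => ?_⟩
    simp only [Finset.mem_filter, Finset.mem_range, Finset.mem_singleton]
    constructor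
    · rintro ⟨hc, hgcd, -⟩
      interval_cases c
      · simp at hgcd
      · rfl
    · rintro rfl
      exact ⟨by norm_num, by norm_num, by simpa [ht₁one] using hdvd⟩
end

section
/- Assume t ≤ 2, g₁ is odd, t₁ is even, gcd(d₁, t₁) = 1, gcd(n₁, 2t₁) = 1, and there exists an integer x with n₁x² + d₁ ≡ 0 (mod 2t₁). Then N(n,d,t) = 1. -/
/-- (see paper, Theorem on |Υ_n^{d,t}|)
`N(n,d,t)` is the number of residue classes `c` mod `t` with `gcd(c,t) = 1` and
`2t₁ ∣ g₁(d₁ + c²n₁)`. -/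
theorem count_case_D_t_small
    (n d t g₀ d₁ n₁ g w g₁ t₁ : ℕ)
    (hn : 2 ≤ n) (hd : 1 ≤ d) (ht : 1 ≤ t) (ht2 : t ≤ 2)
    (hg₀ : g₀ = Nat.gcd (2 * d) (2 * n + 2))
    (htdvd : t ∣ g₀)
    (hd₁ : d₁ = 2 * d / g₀) (hn₁ : n₁ = (2 * n + 2) / g₀)
    (hg : g = g₀ / t) (hw : w = Nat.gcd g t)
    (hg₁ : g₁ = g / w) (ht₁ : t₁ = t / w)
    (hg₁odd : Odd g₁) (ht₁even : Even t₁)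
    (hd₁t₁ : Nat.gcd d₁ t₁ = 1) (hn₁2t₁ : Nat.gcd n₁ (2 * t₁) = 1)
    (hQR : ∃ x : ℤ, (2 * (t₁ : ℤ)) ∣ ((n₁ : ℤ) * x ^ 2 + (d₁ : ℤ))) :
    ((Finset.range t).filter
        (fun c : ℕ => Nat.gcd c t = 1 ∧
          (2 * (t₁ : ℤ)) ∣ ((g₁ : ℤ) * ((d₁ : ℤ) + (c : ℤ) ^ 2 * (n₁ : ℤ))))).card
      = 1 := by
  have hwt : w ∣ t := hw ▸ Nat.gcd_dvd_right g t
  have ht₁t : t₁ ∣ t := ht₁ ▸ Nat.div_dvd_of_dvd hwt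
  have ht₁pos : 0 < t₁ := Nat.pos_of_dvd_of_pos ht₁t ht
  have ht₁le : t₁ ≤ t := Nat.le_of_dvd ht ht₁t
  have ht₁two : t₁ = 2 := by
    obtain ⟨k, hk⟩ := ht₁even
    omega
  have httwo : t = 2 := by omega
  subst ht₁two httwo
  obtain ⟨x, hx⟩ := hQR
  have hd₁odd : Odd d₁ := Nat.coprime_two_right.mp hd₁t₁
  have hxodd : Odd x := by
    by_contra hx'
    rw [Int.not_odd_iff_even] at hx'
    have heven : Even ((n₁ : ℤ) * x ^ 2) := (hx'.pow_of_ne_zero two_ne_zero).mul_left _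
    obtain ⟨a, ha⟩ := heven
    obtain ⟨b, hb⟩ := hd₁odd
    push_cast at hx
    omega
  have hone : (2 * ((2 : ℕ) : ℤ)) ∣ (d₁ : ℤ) + n₁ := by
    obtain ⟨k, hk⟩ := hxodd
    obtain ⟨m, hm⟩ := hx
    refine ⟨m - n₁ * (k ^ 2 + k), ?_⟩
    subst hk
    push_cast at hm ⊢
    linear_combination hm
  rw [Finset.card_eq_one]
  refine ⟨1, Finset.ext fun c => ?_⟩
  simp only [Finset.mem_filter, Finset.mem_range, Finset.mem_singleton]
  constructor
  · rintro ⟨hc, hcop, -⟩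
    interval_cases c
    · simp at hcop
    · rfl
  · rintro rfl
    refine ⟨one_lt_two, Nat.gcd_one_left 2, Dvd.dvd.mul_left ?_ _⟩
    simpa using hone
end

section
/- Assume that none of the following four condition sets holds: (A) g₁ even, gcd(d₁, t₁) = 1, gcd(n₁, t₁) = 1 and ∃x with t₁ ∣ n₁x² + d₁; (B) g₁, t₁, d₁ all odd, gcd(d₁, t₁) = 1, gcd(n₁, 2t₁) = 1 and ∃x with 2t₁ ∣ n₁x² + d₁; (C) g₁, t₁, w all odd, d₁ even, gcd(d₁, t₁) = 1, gcd(n₁, 2t₁) = 1 and ∃x with t₁ ∣ 4n₁x² + d₁; (D) g₁ odd, t₁ even, gcd(d₁, t₁) = 1, gcd(n₁, 2t₁) = 1 and ∃x with 2t₁ ∣ n₁x² + d₁. Then N(n,d,t) = 0, i.e. there is no integer c with gcd(c, t) = 1 and 2t₁ ∣ g₁(d₁ + c²n₁). -/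
/-- If `t ∣ a + c ^ 2 * b` with `a, b` coprime, then `b` is coprime to `t`. -/
theorem isCoprime_right_of_dvd_add_sq_mul {a b c t : ℤ} (hab : IsCoprime a b)
    (h : t ∣ a + c ^ 2 * b) : IsCoprime b t :=
  (hab.symm.add_mul_right_right (c ^ 2)).of_isCoprime_of_dvd_right h

/-- If `t ∣ a + c ^ 2 * b` with `a, b` coprime and `c, t` coprime, then `a` is coprime to `t`. -/
theorem isCoprime_left_of_dvd_add_sq_mul {a b c t : ℤ} (hab : IsCoprime a b)
    (hct : IsCoprime c t) (h : t ∣ a + c ^ 2 * b) : IsCoprime a t := by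
  have hcb : IsCoprime (c ^ 2 * b) t :=
    hct.pow_left.mul_left (isCoprime_right_of_dvd_add_sq_mul hab h)
  obtain ⟨k, hk⟩ := h
  have ha : a = -(c ^ 2 * b) + t * k := by linarith
  rw [ha]
  exact hcb.neg_left.add_mul_left_left k

/-- With the usual context, assume that none of the four condition sets (A), (B),
(C), (D) holds.  Then `N(n,d,t) = 0`, i.e. there is no integer `c` with
`gcd(c,t) = 1` and `2t₁ ∣ g₁(d₁ + c²n₁)`. -/
theorem count_zero_otherwise
    (n d t g₀ d₁ n₁ g w g₁ t₁ : ℕ)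
    (hn : 2 ≤ n) (hd : 1 ≤ d) (ht : 1 ≤ t)
    (hg₀ : g₀ = Nat.gcd (2 * d) (2 * n + 2))
    (htdvd : t ∣ g₀)
    (hd₁ : d₁ = 2 * d / g₀) (hn₁ : n₁ = (2 * n + 2) / g₀)
    (hg : g = g₀ / t) (hw : w = Nat.gcd g t)
    (hg₁ : g₁ = g / w) (ht₁ : t₁ = t / w)
    (hA : ¬ (Even g₁ ∧ Nat.gcd d₁ t₁ = 1 ∧ Nat.gcd n₁ t₁ = 1 ∧
            ∃ x : ℤ, (t₁ : ℤ) ∣ ((n₁ : ℤ) * x ^ 2 + (d₁ : ℤ))))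
    (hB : ¬ (Odd g₁ ∧ Odd t₁ ∧ Odd d₁ ∧ Nat.gcd d₁ t₁ = 1 ∧ Nat.gcd n₁ (2 * t₁) = 1 ∧
            ∃ x : ℤ, (2 * (t₁ : ℤ)) ∣ ((n₁ : ℤ) * x ^ 2 + (d₁ : ℤ))))
    (hC : ¬ (Odd g₁ ∧ Odd t₁ ∧ Odd w ∧ Even d₁ ∧ Nat.gcd d₁ t₁ = 1 ∧
            Nat.gcd n₁ (2 * t₁) = 1 ∧
            ∃ x : ℤ, (t₁ : ℤ) ∣ (4 * (n₁ : ℤ) * x ^ 2 + (d₁ : ℤ))))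
    (hD : ¬ (Odd g₁ ∧ Even t₁ ∧ Nat.gcd d₁ t₁ = 1 ∧ Nat.gcd n₁ (2 * t₁) = 1 ∧
            ∃ x : ℤ, (2 * (t₁ : ℤ)) ∣ ((n₁ : ℤ) * x ^ 2 + (d₁ : ℤ)))) :
    ((Finset.range t).filter
        (fun c : ℕ => Nat.gcd c t = 1 ∧
          (2 * (t₁ : ℤ)) ∣ ((g₁ : ℤ) * ((d₁ : ℤ) + (c : ℤ) ^ 2 * (n₁ : ℤ))))).card
      = 0 ∧
    ¬ ∃ c : ℤ, Int.gcd c (t : ℤ) = 1 ∧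
        (2 * (t₁ : ℤ)) ∣ ((g₁ : ℤ) * ((d₁ : ℤ) + c ^ 2 * (n₁ : ℤ))) := by
  have hg₀pos : 0 < g₀ := hg₀ ▸ Nat.gcd_pos_of_pos_left _ (by omega)
  have hwpos : 0 < w := hw ▸ Nat.gcd_pos_of_pos_right _ ht
  have hdn : Nat.Coprime d₁ n₁ := by
    subst hd₁ hn₁ hg₀
    exact Nat.coprime_div_gcd_div_gcd hg₀pos
  have hgt : Nat.Coprime g₁ t₁ := by
    subst hg₁ ht₁ hw
    exact Nat.coprime_div_gcd_div_gcd hwpos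
  have hwt : w ∣ t := hw ▸ Nat.gcd_dvd_right g t
  have ht₁t : t₁ ∣ t := ht₁ ▸ Nat.div_dvd_of_dvd hwt
  have no_solution : ¬ ∃ c : ℤ, Int.gcd c (t : ℤ) = 1 ∧
      (2 * (t₁ : ℤ)) ∣ ((g₁ : ℤ) * ((d₁ : ℤ) + c ^ 2 * (n₁ : ℤ))) := by
    rintro ⟨c, hct, hc⟩
    have hct : IsCoprime c (t : ℤ) := Int.isCoprime_iff_gcd_eq_one.mpr hct
    have hct₁ : IsCoprime c (t₁ : ℤ) :=
      hct.of_isCoprime_of_dvd_right (Int.natCast_dvd_natCast.mpr ht₁t)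
    have hdn' : IsCoprime (d₁ : ℤ) n₁ := Nat.isCoprime_iff_coprime.mpr hdn
    have hgt' : IsCoprime (t₁ : ℤ) g₁ := (Nat.isCoprime_iff_coprime.mpr hgt).symm
    have hdvd : (t₁ : ℤ) ∣ d₁ + c ^ 2 * n₁ :=
      hgt'.dvd_of_dvd_mul_left ((Dvd.intro_left 2 rfl).trans hc)
    have hnt : Nat.Coprime n₁ t₁ :=
      Nat.isCoprime_iff_coprime.mp (isCoprime_right_of_dvd_add_sq_mul hdn' hdvd)
    have hdt : Nat.Coprime d₁ t₁ :=
      Nat.isCoprime_iff_coprime.mp (isCoprime_left_of_dvd_add_sq_mul hdn' hct₁ hdvd)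
    have hcomm : (d₁ : ℤ) + c ^ 2 * n₁ = n₁ * c ^ 2 + d₁ := by ring
    rcases Nat.even_or_odd g₁ with hge | hgo
    · exact hA ⟨hge, hdt, hnt, c, hcomm ▸ hdvd⟩
    have h2tg : IsCoprime (2 * (t₁ : ℤ)) g₁ :=
      IsCoprime.mul_left (by exact_mod_cast Nat.isCoprime_iff_coprime.mpr hgo.coprime_two_left) hgt'
    have hdvd₂ : 2 * (t₁ : ℤ) ∣ d₁ + c ^ 2 * n₁ := h2tg.dvd_of_dvd_mul_left hc
    have hn2t (h : Odd n₁) : Nat.gcd n₁ (2 * t₁) = 1 := h.coprime_two_right.mul_right hnt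
    have hparity : Even ((d₁ : ℤ) + c ^ 2 * n₁) :=
      even_iff_two_dvd.mpr ((Dvd.intro _ rfl).trans hdvd₂)
    rcases Nat.even_or_odd t₁ with hte | hto
    · have hno : Odd n₁ :=
        Nat.coprime_two_right.mp (Nat.Coprime.coprime_dvd_right hte.two_dvd hnt)
      exact hD ⟨hgo, hte, hdt, hn2t hno, c, hcomm ▸ hdvd₂⟩
    rcases Nat.even_or_odd d₁ with hde | hdo
    · have hno : Odd n₁ :=
        Nat.coprime_two_left.mp (Nat.Coprime.coprime_dvd_left hde.two_dvd hdn)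
      have hce : Even c := by
        have hde' : Even (d₁ : ℤ) := by exact_mod_cast hde
        have hno' : ¬ Even (n₁ : ℤ) := by exact_mod_cast Nat.not_even_iff_odd.mpr hno
        have hcn := (Int.even_add.mp hparity).mp hde'
        rw [Int.even_mul] at hcn
        exact (Int.even_pow.mp (hcn.resolve_right hno')).1
      have hwo : Odd w := by
        have h2t : IsCoprime ((2 : ℕ) : ℤ) t :=
          hct.of_isCoprime_of_dvd_left (by exact_mod_cast hce.two_dvd)
        exact (Nat.coprime_two_left.mp (Nat.isCoprime_iff_coprime.mp h2t)).of_dvd_nat hwt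
      obtain ⟨x, rfl⟩ := hce.two_dvd
      refine hC ⟨hgo, hto, hwo, hde, hdt, hn2t hno, x, ?_⟩
      have hx : 4 * (n₁ : ℤ) * x ^ 2 + d₁ = d₁ + (2 * x) ^ 2 * n₁ := by ring
      exact hx ▸ hdvd
    · have hno : Odd n₁ := by
        have hdo' : ¬ Even (d₁ : ℤ) := by exact_mod_cast Nat.not_even_iff_odd.mpr hdo
        rw [← Nat.not_even_iff_odd]
        intro hne
        have hne' : Even (n₁ : ℤ) := by exact_mod_cast hne
        exact hdo' ((Int.even_add.mp hparity).mpr (hne'.mul_left _))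
      exact hB ⟨hgo, hto, hdo, hdt, hn2t hno, c, hcomm ▸ hdvd₂⟩
  refine ⟨?_, no_solution⟩
  rw [Finset.card_eq_zero, Finset.filter_eq_empty_iff]
  rintro c - ⟨hct, hc⟩
  exact no_solution ⟨c, by simpa using hct, hc⟩
end

section
/- For every h ∈ ℤ⁷ there exists u ∈ ℤ⁷ with B(u, u) = −2 and B(h, u) = 0, where B is the symmetric bilinear form of the lattice Λ_n = U ⊕ U ⊕ U ⊕ ⟨−2n−2⟩. -/
/-- The symmetric bilinear form of the lattice
`Λ_n = U ⊕ U ⊕ U ⊕ ⟨-2n-2⟩` on `ℤ⁷`: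
`B(x,y) = x₁y₂ + x₂y₁ + x₃y₄ + x₄y₃ + x₅y₆ + x₆y₅ - (2n+2)x₇y₇`. -/
def kummerForm (n : ℕ) (x y : Fin 7 → ℤ) : ℤ :=
  x 0 * y 1 + x 1 * y 0 + x 2 * y 3 + x 3 * y 2 + x 4 * y 5 + x 5 * y 4
    - (2 * (n : ℤ) + 2) * (x 6 * y 6)

/-- An integral linear functional on `2 × 2` matrices, transported along a column operation. -/
lemma exists_det_one_of_column_operation {a b c d : ℤ} (q : ℤ)
    (H : ∃ x y z w : ℤ, x * w - y * z = 1 ∧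
      (b - q * a) * x + -a * y + (d - q * c) * z + -c * w = 0) :
    ∃ x y z w : ℤ, x * w - y * z = 1 ∧ a * x + b * y + c * z + d * w = 0 := by
  obtain ⟨x, y, z, w, hdet, hL⟩ := H
  exact ⟨-(q * x + y), x, -(q * z + w), z, by linear_combination hdet, by linear_combination hL⟩

lemma exists_det_one_of_transpose {a b c d : ℤ}
    (H : ∃ x y z w : ℤ, x * w - y * z = 1 ∧ a * x + c * y + b * z + d * w = 0) :
    ∃ x y z w : ℤ, x * w - y * z = 1 ∧ a * x + b * y + c * z + d * w = 0 := by
  obtain ⟨x, y, z, w, hdet, hL⟩ := H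
  exact ⟨x, z, y, w, by linear_combination hdet, by linear_combination hL⟩

lemma exists_det_one_of_ne_zero (a b c d : ℤ) (ha : a ≠ 0) :
    ∃ x y z w : ℤ, x * w - y * z = 1 ∧ a * x + b * y + c * z + d * w = 0 := by
  induction hm : a.natAbs using Nat.strong_induction_on generalizing a b c d with
  | _ m ih =>
    have of_not_dvd : ∀ b c : ℤ, ¬ a ∣ b →
        ∃ x y z w : ℤ, x * w - y * z = 1 ∧ a * x + b * y + c * z + d * w = 0 := by
      intro b c hb
      have hr : b - b / a * a = b % a := by linear_combination -Int.emod_add_mul_ediv b a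
      have hlt := Int.emod_lt_abs b ha
      have hnonneg := Int.emod_nonneg b ha
      refine exists_det_one_of_column_operation (b / a) (ih _ ?_ _ _ _ _ ?_ rfl)
      · rw [hr]
        rw [Int.abs_eq_natAbs] at hlt
        omega
      · rw [hr]
        exact fun h0 => hb (Int.dvd_of_emod_eq_zero h0)
    by_cases hb : a ∣ b
    · by_cases hc : a ∣ c
      · obtain ⟨k, rfl⟩ := hb
        obtain ⟨l, rfl⟩ := hc
        exact ⟨l - k, 1, -1, 0, by ring, by ring⟩
      · exact exists_det_one_of_transpose (of_not_dvd c b hc)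
    · exact of_not_dvd b c hb

/-- Every integral linear functional on `2 × 2` matrices vanishes on a matrix of determinant one. -/
lemma exists_det_one_linear_eq_zero (a b c d : ℤ) :
    ∃ x y z w : ℤ, x * w - y * z = 1 ∧ a * x + b * y + c * z + d * w = 0 := by
  have of_ne_zero : ∀ b c : ℤ, b ≠ 0 →
      ∃ x y z w : ℤ, x * w - y * z = 1 ∧ a * x + b * y + c * z + d * w = 0 := fun b c hb =>
    exists_det_one_of_column_operation 0 (exists_det_one_of_ne_zero _ _ _ _ (by simpa using hb))
  by_cases hb : b = 0
  · by_cases hc : c = 0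
    · exact ⟨0, 1, -1, 0, by ring, by rw [hb, hc]; ring⟩
    · exact exists_det_one_of_transpose (of_ne_zero c b hc)
  · exact of_ne_zero b c hb

/-- (Eichler criterion existence of a `(-2)`-class orthogonal to `h`.)
For every `h ∈ ℤ⁷` there exists `u ∈ ℤ⁷` with `B(u,u) = -2` and `B(h,u) = 0`,
where `B` is the bilinear form of `Λ_n = U ⊕ U ⊕ U ⊕ ⟨-2n-2⟩` and `n ≥ 2`. -/
theorem exists_minus_two_class_orthogonal
    (n : ℕ) (hn : 2 ≤ n) (h : Fin 7 → ℤ) :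
    ∃ u : Fin 7 → ℤ, kummerForm n u u = -2 ∧ kummerForm n h u = 0 := by
  obtain ⟨x, y, z, w, hdet, hL⟩ := exists_det_one_linear_eq_zero (-h 1) (h 3) (h 2) (h 0)
  refine ⟨![-x, w, y, z, 0, 0, 0], ?_, ?_⟩
  · simp [kummerForm]
    linear_combination -2 * hdet
  · simp [kummerForm]
    linear_combination hL
end
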